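/- Let Ω ⊂ ℝ^d be an open bounded domain satisfying the geodesic condition (D), let the kernel η satisfy (K1)–(K3), and let (s_n) ⊂ (0,∞) be a null sequence. Then every sequence (u_n) ⊂ L^∞(Ω) that is bounded in the L^∞ norm and satisfies sup_{n∈ℕ} F_{s_n}(u_n) < ∞ is relatively compact in L^∞(Ω). -/

import Mathlib

open MeasureTheory Filter Set Topology ENNReal

noncomputable section

/-- Euclidean space `ℝ^d`. -/
abbrev Euc (d : ℕ) := EuclideanSpace ℝ (Fin d)

variable {d : ℕ}

/-- The geodesic distance on `Ω` induced by the Euclidean distance: the infimal length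
(`eVariationOn`, i.e. the supremum of sums of distances over partitions) of continuous curves
`γ : [0,1] → ℝ^d` with `γ((0,1)) ⊆ Ω` (so that also endpoints in `∂Ω` can be reached),
`γ 0 = x` and `γ 1 = y`. -/
def geoDist (Ω : Set (Euc d)) (x y : Euc d) : ℝ≥0∞ :=
  ⨅ (γ : ℝ → Euc d) (_ : ContinuousOn γ (Set.Icc 0 1))
    (_ : Set.MapsTo γ (Set.Ioo 0 1) Ω) (_ : γ 0 = x) (_ : γ 1 = y),
    eVariationOn γ (Set.Icc 0 1)

/-- The geodesic distance function to a set `O`. -/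
def dGeo (Ω O : Set (Euc d)) (x : Euc d) : ℝ :=
  (⨅ y ∈ O, geoDist Ω x y).toReal

/-- Condition (D): `lim_{δ↓0} sup { d_Ω(x,y)/|x-y| : x,y ∈ Ω, |x-y| < δ } ≤ 1`. -/
def condD (Ω : Set (Euc d)) : Prop :=
  ∀ ε : ℝ, 0 < ε → ∃ δ : ℝ, 0 < δ ∧ ∀ x ∈ Ω, ∀ y ∈ Ω,
    dist x y < δ → geoDist Ω x y ≤ ENNReal.ofReal ((1 + ε) * dist x y)

/-- The kernel assumptions (K1)–(K3): `η : [0,∞) → [0,∞)` is positive and continuous at `0`,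
non-increasing, and has support contained in `[0,c]`. -/
structure IsKernel (η : ℝ → ℝ) (c : ℝ) : Prop where
  nonneg : ∀ t, 0 ≤ η t
  pos_zero : 0 < η 0
  cont_zero : ContinuousAt η 0
  antitone : AntitoneOn η (Set.Ici 0)
  c_pos : 0 < c
  compact_supp : ∀ t, c < t → η t = 0

/-- `σ_η := esssup_{t ≥ 0} η(t)·t`. -/
def sigmaEta (η : ℝ → ℝ) : ℝ≥0∞ :=
  essSup (fun t => ENNReal.ofReal (η t * t)) (volume.restrict (Set.Ici (0 : ℝ)))

/-- The `L^∞(Ω)` norm of a function. -/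
def einfNorm (Ω : Set (Euc d)) (u : Euc d → ℝ) : ℝ≥0∞ :=
  essSup (fun x => (‖u x‖₊ : ℝ≥0∞)) (volume.restrict Ω)

/-- Convergence in `L^∞(Ω)`. -/
def TendstoLinf (Ω : Set (Euc d)) (un : ℕ → Euc d → ℝ) (u : Euc d → ℝ) : Prop :=
  Filter.Tendsto (fun n => einfNorm Ω (fun x => un n x - u x)) Filter.atTop (nhds 0)

/-- A sequence is relatively compact in `L^∞(Ω)` iff every subsequence has a further
subsequence converging in `L^∞(Ω)`. -/
def SeqRelCompactLinf (Ω : Set (Euc d)) (un : ℕ → Euc d → ℝ) : Prop :=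
  ∀ φ : ℕ → ℕ, StrictMono φ → ∃ ψ : ℕ → ℕ, StrictMono ψ ∧
    ∃ v : Euc d → ℝ, TendstoLinf Ω (fun k => un (φ (ψ k))) v

/-- The non-local functional `F_s(u) = (1/s) esssup_{x,y∈Ω} η(|x-y|/s) |u(x) - u(y)|`. -/
def Fnl (Ω : Set (Euc d)) (η : ℝ → ℝ) (s : ℝ) (u : Euc d → ℝ) : ℝ≥0∞ :=
  ENNReal.ofReal (1 / s) *
    essSup (fun q : Euc d × Euc d => ENNReal.ofReal (η (dist q.1 q.2 / s) * |u q.1 - u q.2|))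
      ((volume.restrict Ω).prod (volume.restrict Ω))

/-- `v` is locally Lipschitz on `Ω`. -/
def LocLipOn (Ω : Set (Euc d)) (v : Euc d → ℝ) : Prop :=
  ∀ x ∈ Ω, ∃ ε : ℝ, 0 < ε ∧ ∃ K : NNReal, LipschitzOnWith K v (Metric.ball x ε ∩ Ω)

/-- `esssup_{x ∈ Ω} |∇v(x)|`. -/
def gradSup (Ω : Set (Euc d)) (v : Euc d → ℝ) : ℝ≥0∞ :=
  essSup (fun x => (‖fderiv ℝ v x‖₊ : ℝ≥0∞)) (volume.restrict Ω)

/-- The continuum functional `F(u) = esssup_{x∈Ω} |∇u(x)|` if `u ∈ W^{1,∞}(Ω)`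
(i.e. `u` has a locally Lipschitz representative on `Ω`, whose a.e. gradient is then taken),
and `F(u) = ∞` otherwise. -/
def Floc (Ω : Set (Euc d)) (u : Euc d → ℝ) : ℝ≥0∞ :=
  ⨅ (v : Euc d → ℝ) (_ : u =ᵐ[volume.restrict Ω] v) (_ : LocLipOn Ω v), gradSup Ω v

/-- The constrained continuum functional: additionally the representative must equal `g` on `O`. -/
def FlocCons (Ω O : Set (Euc d)) (g : Euc d → ℝ) (u : Euc d → ℝ) : ℝ≥0∞ :=
  ⨅ (v : Euc d → ℝ) (_ : u =ᵐ[volume.restrict Ω] v) (_ : LocLipOn Ω v)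
    (_ : Set.EqOn v g O), gradSup Ω v

/-- The discrete functional `E_n(𝐮) = (1/s) max_{x,y ∈ Ω_n} η(|x-y|/s) |𝐮(x) - 𝐮(y)|`. -/
def Edisc (Ωn : Set (Euc d)) (η : ℝ → ℝ) (s : ℝ) (f : Euc d → ℝ) : ℝ≥0∞ :=
  ENNReal.ofReal (1 / s) *
    ⨆ (x : Euc d) (_ : x ∈ Ωn) (y : Euc d) (_ : y ∈ Ωn),
      ENNReal.ofReal (η (dist x y / s) * |f x - f y|)

/-- The constrained discrete functional, extended to `L^∞(Ω)`: its value is `E_n(f)` if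
`u = f ∘ pₙ` (as elements of `L^∞(Ω)`) for a graph function `f` with `f = g` on `Oₙ`,
and `∞` otherwise. -/
def EdiscCons (Ω Ωn On : Set (Euc d)) (pn : Euc d → Euc d) (g : Euc d → ℝ)
    (η : ℝ → ℝ) (s : ℝ) (u : Euc d → ℝ) : ℝ≥0∞ :=
  ⨅ (f : Euc d → ℝ) (_ : u =ᵐ[volume.restrict Ω] fun x => f (pn x))
    (_ : Set.EqOn f g On), Edisc Ωn η s f

/-- `pn` is a closest point projection from `Ω` onto `Ωn`. -/
def IsCPP (Ω Ωn : Set (Euc d)) (pn : Euc d → Euc d) : Prop :=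
  ∀ x ∈ Ω, pn x ∈ Ωn ∧ ∀ y ∈ Ωn, dist x (pn x) ≤ dist x y

/-- The resolution `rₙ = sup_{x ∈ Ω} min_{y ∈ Ωₙ} |x - y|`. -/
def resol (Ω Ωn : Set (Euc d)) : ℝ := ⨆ x ∈ Ω, Metric.infDist x Ωn


/-- A property that holds almost everywhere on an open set holds at points of the set arbitrarily
close to any of its points. -/
theorem exists_dist_lt_of_ae_restrict {E : Type*} [PseudoMetricSpace E] [MeasurableSpace E]
    [OpensMeasurableSpace E] {μ : Measure E} [μ.IsOpenPosMeasure] {Ω : Set E} (hΩ : IsOpen Ω)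
    {Q : E → Prop} (hQ : ∀ᵐ q ∂μ.restrict Ω, Q q) {p : E} (hp : p ∈ Ω) {h : ℝ} (hh : 0 < h) :
    ∃ q ∈ Ω, dist q p < h ∧ Q q := by
  rw [ae_restrict_iff' hΩ.measurableSet] at hQ
  obtain ⟨q, ⟨hqΩ, hqp⟩, hq⟩ := (Measure.dense_of_ae hQ).inter_open_nonempty
    (Ω ∩ Metric.ball p h) (hΩ.inter Metric.isOpen_ball) ⟨p, hp, Metric.mem_ball_self hh⟩
  exact ⟨q, hqΩ, hqp, hq hqΩ⟩

/-- If `u` oscillates by at most `K` at distances below `3 * h` on an `h`-dense subset `G` of `Ω`,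
then it oscillates by at most `(k + 1) * K` between points of `G` near the endpoints of a curve
in `Ω` of length at most `k * h`. -/
theorem abs_sub_le_of_eVariationOn_le {E : Type*} [PseudoMetricSpace E] {Ω G : Set E} {u : E → ℝ}
    {h K : ℝ} (hh : 0 < h) (hG : ∀ p ∈ Ω, ∃ q ∈ G, dist q p < h)
    (hu : ∀ q ∈ G, ∀ q' ∈ G, dist q q' < 3 * h → |u q - u q'| ≤ K) {γ : ℝ → E} {b : ℝ} (k : ℕ)
    {a : ℝ} (hab : a ≤ b) (hγ : ContinuousOn γ (Icc a b)) (hγΩ : MapsTo γ (Icc a b) Ω)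
    (hvar : eVariationOn γ (Icc a b) ≤ ENNReal.ofReal (k * h)) {q q' : E} (hq : q ∈ G)
    (hq' : q' ∈ G) (hqa : dist q (γ a) < h) (hqb : dist q' (γ b) < h) :
    |u q - u q'| ≤ (k + 1) * K := by
  have hK : 0 ≤ K := (abs_nonneg _).trans (hu q hq q hq (by simpa using hh))
  by_cases hd : dist (γ a) (γ b) ≤ h
  · have h1 : dist q q' < 3 * h := by
      have := dist_triangle4 q (γ a) (γ b) q'
      rw [dist_comm (γ b)] at this
      linarith
    have h2 : 0 ≤ (k : ℝ) * K := by positivity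
    linarith [hu q hq q' hq' h1]
  push Not at hd
  induction k generalizing a q with
  | zero =>
    have h1 := (eVariationOn.edist_le γ (left_mem_Icc.2 hab) (right_mem_Icc.2 hab)).trans hvar
    rw [edist_dist] at h1
    have h2 := (ENNReal.ofReal_le_ofReal_iff (by simp)).1 h1
    simp at h2
    linarith
  | succ k ih =>
    obtain ⟨t, ht, hth⟩ : h ∈ (fun t => dist (γ a) (γ t)) '' Icc a b :=
      intermediate_value_Icc hab (by fun_prop) ⟨by simpa using hh.le, hd.le⟩
    obtain ⟨z, hz, hzt⟩ := hG _ (hγΩ ht)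
    have hsub : Icc t b ⊆ Icc a b := Icc_subset_Icc_left ht.1
    have hvar' : eVariationOn γ (Icc t b) ≤ ENNReal.ofReal (k * h) := by
      have h1 := eVariationOn.Icc_add_Icc γ (s := univ) ht.1 ht.2 (mem_univ t)
      simp only [univ_inter] at h1
      have h2 := eVariationOn.edist_le γ (left_mem_Icc.2 ht.1) (right_mem_Icc.2 ht.1)
      rw [edist_dist, show dist (γ a) (γ t) = h from hth] at h2
      have h3 : ENNReal.ofReal h + eVariationOn γ (Icc t b)
          ≤ ENNReal.ofReal h + ENNReal.ofReal (k * h) := by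
        rw [← ENNReal.ofReal_add hh.le (by positivity)]
        calc _ ≤ eVariationOn γ (Icc a b) := by rw [← h1]; gcongr
          _ ≤ _ := hvar
          _ = _ := by push_cast; ring_nf
      exact (ENNReal.add_le_add_iff_left ENNReal.ofReal_ne_top).1 h3
    have hqz : |u q - u z| ≤ K := by
      refine hu q hq z hz ?_
      have := dist_triangle4 q (γ a) (γ t) z
      rw [dist_comm (γ t)] at this
      simp only at hth
      linarith
    have hzq : |u z - u q'| ≤ (k + 1) * K := by
      by_cases hd' : dist (γ t) (γ b) ≤ h
      · have h1 : dist z q' < 3 * h := by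
          have := dist_triangle4 z (γ t) (γ b) q'
          rw [dist_comm (γ b)] at this
          linarith
        have h2 : 0 ≤ (k : ℝ) * K := by positivity
        linarith [hu z hz q' hq' h1]
      · exact ih ht.2 (hγ.mono hsub) (hγΩ.mono_left hsub) hvar' hz hzt (not_le.1 hd')
    push_cast
    linarith [abs_sub_le (u q) (u z) (u q')]

/-- A sequence of functions that is bounded and asymptotically uniformly equicontinuous on a
totally bounded set has a subsequence converging uniformly there. -/
theorem exists_subseq_tendstoUniformlyOn {E : Type*} [PseudoMetricSpace E] {G : Set E}
    (hG : TotallyBounded G) {f : ℕ → E → ℝ} {M : ℝ} (hM : ∀ n, ∀ x ∈ G, |f n x| ≤ M)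
    (hf : ∀ ε > 0, ∃ ρ > 0, ∃ N, ∀ n ≥ N, ∀ x ∈ G, ∀ y ∈ G, dist x y < ρ → |f n x - f n y| < ε) :
    ∃ ψ : ℕ → ℕ, StrictMono ψ ∧ ∃ v : E → ℝ,
      TendstoUniformlyOn (fun k => f (ψ k)) v atTop G := by
  choose! T hTG hTfin hT using Metric.finite_approx_of_totallyBounded hG
  set D : Set E := ⋃ j : ℕ, T (1 / ((j : ℝ) + 1))
  have hDc : D.Countable :=
    countable_iUnion fun j => (hTfin _ Nat.one_div_pos_of_nat).countable
  have hDG : D ⊆ G := iUnion_subset fun j => hTG _ Nat.one_div_pos_of_nat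
  have : Countable D := hDc.to_subtype
  obtain ⟨g, -, ψ, hψ, hg⟩ :=
    (isCompact_univ_pi fun _ : D => isCompact_Icc (a := -M) (b := M)).tendsto_subseq
    (x := fun n (x : D) => f n x) fun n x _ => abs_le.1 (hM n x (hDG x.2))
  have hcau : ∀ x ∈ D, CauchySeq fun k => f (ψ k) x := fun x hx =>
    ((tendsto_pi_nhds.1 hg) ⟨x, hx⟩).cauchySeq
  have hunif : UniformCauchySeqOn (fun k => f (ψ k)) atTop G := by
    rw [Metric.uniformCauchySeqOn_iff]
    intro ε hε
    obtain ⟨ρ, hρ, N, hN⟩ := hf (ε / 3) (by positivity)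
    obtain ⟨j, hj⟩ := exists_nat_one_div_lt hρ
    have hj0 : 0 < 1 / ((j : ℝ) + 1) := Nat.one_div_pos_of_nat
    choose! L hL using fun x (hx : x ∈ D) =>
      Metric.cauchySeq_iff.1 (hcau x hx) (ε / 3) (by positivity)
    obtain ⟨B, hB⟩ := ((hTfin _ hj0).image L).bddAbove
    refine ⟨max N B, fun m hm n hn x hx => ?_⟩
    obtain ⟨z, hz, hxz⟩ := mem_iUnion₂.1 (hT _ hj0 hx)
    have hzD : z ∈ D := mem_iUnion.2 ⟨j, hz⟩
    have hLB : L z ≤ B := hB (mem_image_of_mem L hz)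
    have hz' := hL z hzD m (by omega) n (by omega)
    have h1 := hN (ψ m) (((le_max_left N B).trans hm).trans (hψ.id_le m)) x hx z
      (hDG hzD) (lt_trans hxz hj)
    have h2 := hN (ψ n) (((le_max_left N B).trans hn).trans (hψ.id_le n)) x hx z
      (hDG hzD) (lt_trans hxz hj)
    rw [Real.dist_eq] at hz' ⊢
    rw [abs_lt] at *
    constructor <;> linarith
  choose! v hv using fun x (hx : x ∈ G) => cauchySeq_tendsto_of_complete (hunif.cauchySeq hx)
  exact ⟨ψ, hψ, v, hunif.tendstoUniformlyOn_of_tendsto hv⟩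

/-- Uniform convergence on a conull subset of `Ω` implies convergence in `L^∞(Ω)`. -/
theorem TendstoLinf.of_tendstoUniformlyOn {Ω G : Set (Euc d)} {un : ℕ → Euc d → ℝ}
    {v : Euc d → ℝ} (hG : ∀ᵐ x ∂volume.restrict Ω, x ∈ G)
    (h : TendstoUniformlyOn un v atTop G) : TendstoLinf Ω un v := by
  rw [TendstoLinf, ENNReal.tendsto_nhds_zero]
  intro ε hε
  filter_upwards [Metric.tendstoUniformlyOn_iff.1 h _ (ENNReal.toReal_pos
    (lt_min hε one_pos).ne' (by simp : min ε 1 ≠ ⊤))] with n hn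
  refine essSup_le_of_ae_le _ ?_
  filter_upwards [hG] with x hx
  have h1 := hn x hx
  rw [dist_comm, Real.dist_eq] at h1
  refine le_trans ?_ (min_le_left ε 1)
  rw [← ENNReal.ofReal_toReal (by simp : min ε 1 ≠ ⊤), ← enorm_eq_nnnorm, ← ofReal_norm,
    Real.norm_eq_abs]
  exact ENNReal.ofReal_le_ofReal h1.le

/-- A function with finite `L^∞` norm is bounded almost everywhere by that norm. -/
theorem ae_abs_le_of_einfNorm_le {Ω : Set (Euc d)} {u : Euc d → ℝ} {M : ℝ≥0∞} (hM : M ≠ ⊤)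
    (h : einfNorm Ω u ≤ M) : ∀ᵐ x ∂volume.restrict Ω, |u x| ≤ M.toReal := by
  filter_upwards [ENNReal.ae_le_essSup (fun x => (‖u x‖₊ : ℝ≥0∞))] with x hx
  have h1 := ENNReal.toReal_mono hM (hx.trans h)
  simpa using h1

/-- A kernel is bounded below by a positive constant near `0`. -/
theorem IsKernel.exists_le {η : ℝ → ℝ} {c : ℝ} (hη : IsKernel η c) :
    ∃ m > 0, ∃ t > 0, ∀ r, 0 ≤ r → r < t → m ≤ η r := by
  obtain ⟨t, ht, h⟩ := Metric.eventually_nhds_iff.1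
    (hη.cont_zero.eventually_const_le (half_lt_self hη.pos_zero))
  refine ⟨η 0 / 2, half_pos hη.pos_zero, t, ht, fun r hr hrt => h ?_⟩
  simpa [abs_of_nonneg hr] using hrt

/-- Functions with bounded non-local energy oscillate little at small distances, on a conull
subset of `Ω`. -/
theorem ae_ae_abs_sub_le_of_Fnl_le {Ω : Set (Euc d)} {η : ℝ → ℝ} {s m t : ℝ} (hs : 0 < s)
    (hm : 0 < m) (hη : ∀ r, 0 ≤ r → r < t → m ≤ η r) {u : Euc d → ℝ} {B : ℝ≥0∞} (hB : B ≠ ⊤)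
    (h : Fnl Ω η s u ≤ B) :
    ∀ᵐ x ∂volume.restrict Ω, ∀ᵐ y ∂volume.restrict Ω,
      dist x y < t * s → |u x - u y| ≤ B.toReal * s / m := by
  refine Measure.ae_ae_of_ae_prod (p := fun q : Euc d × Euc d =>
    dist q.1 q.2 < t * s → |u q.1 - u q.2| ≤ B.toReal * s / m) ?_
  filter_upwards [ENNReal.ae_le_essSup (fun q : Euc d × Euc d =>
    ENNReal.ofReal (η (dist q.1 q.2 / s) * |u q.1 - u q.2|))] with q hq hlt
  have h1 : ENNReal.ofReal (1 / s) * ENNReal.ofReal (η (dist q.1 q.2 / s) * |u q.1 - u q.2|)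
      ≤ B := le_trans (mul_le_mul_right hq _) h
  rw [← ENNReal.ofReal_mul (by positivity), ENNReal.ofReal_le_iff_le_toReal hB] at h1
  have h2 := hη (dist q.1 q.2 / s) (by positivity) ((div_lt_iff₀ hs).2 hlt)
  rw [le_div_iff₀ hm, ← div_le_iff₀ hs]
  calc |u q.1 - u q.2| * m / s = 1 / s * (m * |u q.1 - u q.2|) := by ring
    _ ≤ 1 / s * (η (dist q.1 q.2 / s) * |u q.1 - u q.2|) := by gcongr
    _ ≤ _ := h1

/-- A bound on the oscillation of `u` for almost every pair of close points of an open set holds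
up to a factor `2` for every pair of close points of a conull subset. -/
theorem abs_sub_le_two_mul_of_ae {Ω : Set (Euc d)} (hΩ : IsOpen Ω) {u : Euc d → ℝ} {r A : ℝ}
    {x y : Euc d} (hx : x ∈ Ω)
    (hxA : ∀ᵐ z ∂volume.restrict Ω, dist x z < r → |u x - u z| ≤ A)
    (hyA : ∀ᵐ z ∂volume.restrict Ω, dist y z < r → |u y - u z| ≤ A) (hxy : dist x y < r) :
    |u x - u y| ≤ 2 * A := by
  obtain ⟨z, -, hzx, hz1, hz2⟩ := exists_dist_lt_of_ae_restrict hΩ (hxA.and hyA) hx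
    (sub_pos.2 hxy)
  have h1 : dist y z < r := by
    linarith [dist_triangle y x z, dist_comm x y, dist_comm z x]
  have h2 : dist x z < r := by
    linarith [dist_nonneg (x := x) (y := y), dist_comm z x]
  have h3 := hz1 h2
  have h4 := hz2 h1
  rw [abs_le] at *
  constructor <;> linarith

/-- A geodesic distance below `L` bounds the oscillation of `u` linearly in `L / h`. -/
theorem abs_sub_le_of_geoDist_lt {Ω G : Set (Euc d)} {u : Euc d → ℝ} {h K L : ℝ} (hh : 0 < h)
    (hGΩ : G ⊆ Ω) (hG : ∀ p ∈ Ω, ∃ q ∈ G, dist q p < h)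
    (hu : ∀ q ∈ G, ∀ q' ∈ G, dist q q' < 3 * h → |u q - u q'| ≤ K) {x y : Euc d} (hx : x ∈ G)
    (hy : y ∈ G) (hL : 0 ≤ L) (hxy : geoDist Ω x y < ENNReal.ofReal L) :
    |u x - u y| ≤ (L / h + 2) * K := by
  have hK : 0 ≤ K := (abs_nonneg _).trans (hu x hx x hx (by simpa using hh))
  simp only [geoDist, iInf_lt_iff] at hxy
  obtain ⟨γ, hγ, hγΩ, rfl, rfl, hvar⟩ := hxy
  have hmaps : MapsTo γ (Icc 0 1) Ω := by
    intro t ht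
    rcases eq_endpoints_or_mem_Ioo_of_mem_Icc ht with rfl | rfl | ht
    exacts [hGΩ hx, hGΩ hy, hγΩ ht]
  have hceil : L ≤ ⌈L / h⌉₊ * h := (div_le_iff₀ hh).1 (Nat.le_ceil _)
  refine (abs_sub_le_of_eVariationOn_le hh hG hu ⌈L / h⌉₊ zero_le_one hγ hmaps
    (hvar.le.trans (ENNReal.ofReal_le_ofReal hceil)) hx hy (by simpa) (by simpa)).trans ?_
  gcongr ?_ * K
  linarith [Nat.ceil_lt_add_one (div_nonneg hL hh.le)]

/-- Compactness for the non-local functionals: bounded sequences with uniformly bounded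
non-local energies are relatively compact in `L^∞(Ω)`. -/
theorem statement_11 {d : ℕ} (Ω : Set (Euc d)) (hΩo : IsOpen Ω) (hΩc : IsConnected Ω)
    (hΩb : Bornology.IsBounded Ω) (hD : condD Ω)
    (η : ℝ → ℝ) (c : ℝ) (hη : IsKernel η c)
    (s : ℕ → ℝ) (hs : ∀ n, 0 < s n) (hs0 : Filter.Tendsto s Filter.atTop (nhds 0))
    (un : ℕ → Euc d → ℝ)
    (hbd : (⨆ n, einfNorm Ω (un n)) ≠ ⊤)
    (hF : (⨆ n, Fnl Ω η (s n) (un n)) ≠ ⊤) :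
    SeqRelCompactLinf Ω un := by
  intro φ hφ
  obtain ⟨m, hm, t, ht, hmt⟩ := hη.exists_le
  obtain ⟨δ, hδ, hgeo⟩ := hD 1 one_pos
  set B := ⨆ n, Fnl Ω η (s n) (un n)
  set M := ⨆ n, einfNorm Ω (un n)
  set b := B.toReal
  have hb0 : 0 ≤ b := ENNReal.toReal_nonneg
  set G : Set (Euc d) := {x | x ∈ Ω ∧ ∀ n, |un n x| ≤ M.toReal ∧
    ∀ᵐ y ∂volume.restrict Ω, dist x y < t * s n → |un n x - un n y| ≤ b * s n / m}
  have hGae : ∀ᵐ x ∂volume.restrict Ω, x ∈ G := by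
    have h1 : ∀ᵐ x ∂volume.restrict Ω, ∀ n, |un n x| ≤ M.toReal := ae_all_iff.2 fun n =>
      ae_abs_le_of_einfNorm_le hbd (le_iSup (fun n => einfNorm Ω (un n)) n)
    have h2 := ae_all_iff.2 fun n => ae_ae_abs_sub_le_of_Fnl_le (hs n) hm hmt hF
      (le_iSup (fun n => Fnl Ω η (s n) (un n)) n)
    filter_upwards [h1, h2, ae_restrict_mem hΩo.measurableSet] with x hx1 hx2 hx
    exact ⟨hx, fun n => ⟨hx1 n, hx2 n⟩⟩
  have hGΩ : G ⊆ Ω := fun x hx => hx.1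
  have hosc : ∀ n, ∀ x ∈ G, ∀ y ∈ G, dist x y < δ →
      |un n x - un n y| ≤ ((2 * dist x y + s n) / (t * s n / 3) + 2) * (2 * (b * s n / m)) := by
    intro n x hx y hy hxy
    have hsn := hs n
    have hh : 0 < t * s n / 3 := by positivity
    refine abs_sub_le_of_geoDist_lt hh hGΩ (fun p hp => ?_) (fun q hq q' hq' hqq => ?_) hx hy
      (by positivity) ((hgeo x hx.1 y hy.1 hxy).trans_lt ?_)
    · obtain ⟨q, -, hqp, hq⟩ := exists_dist_lt_of_ae_restrict hΩo hGae hp hh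
      exact ⟨q, hq, hqp⟩
    · exact abs_sub_le_two_mul_of_ae hΩo hq.1 (hq.2 n).2 (hq'.2 n).2 (by linarith)
    · rw [ENNReal.ofReal_lt_ofReal_iff (by positivity)]
      linarith
  have hlin : ∀ n, ∀ x ∈ G, ∀ y ∈ G, dist x y < δ →
      |un n x - un n y| ≤ 12 * b / (t * m) * dist x y + (6 / t + 4) * (b / m) * s n := by
    intro n x hx y hy hxy
    have hsn := hs n
    refine (hosc n x hx y hy hxy).trans_eq ?_
    field_simp
    ring
  have hGtb : TotallyBounded G := (hΩb.isCompact_closure.totallyBounded.subset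
    (hGΩ.trans subset_closure))
  obtain ⟨ψ, hψ, v, hv⟩ := exists_subseq_tendstoUniformlyOn hGtb (f := fun k => un (φ k))
    (M := M.toReal) (fun n x hx => (hx.2 _).1) (by
      intro ε hε
      have hC1 : 0 ≤ 12 * b / (t * m) := by positivity
      obtain ⟨N, hN⟩ := eventually_atTop.1 (((hs0.comp hφ.tendsto_atTop).const_mul
        ((6 / t + 4) * (b / m))).eventually_lt_const (u := ε / 2)
          (by simpa using hε))
      refine ⟨min δ (ε / 2 / (12 * b / (t * m) + 1)), by positivity, N,
        fun n hn x hx y hy hxy => ?_⟩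
      have h1 := hlin (φ n) x hx y hy (hxy.trans_le (min_le_left _ _))
      have h2 := (lt_div_iff₀ (by positivity)).1 (hxy.trans_le (min_le_right _ _))
      have h3 := hN n hn
      simp only [Function.comp_apply] at h3
      linarith [dist_nonneg (x := x) (y := y)])
  exact ⟨ψ, hψ, v, .of_tendstoUniformlyOn hGae hv⟩


end
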